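/- Let R be a d-dimensional Cohen-Macaulay commutative noetherian ring with a dualizing module D, and let p ∈ Spec(R). If J is the minimal injective resolution of D over R, then Hom_R(J, E_R(R/p)) is a flat resolution, over R and over R_p, of Hom_R(D, E_R(R/p)) ≅ Hom_{R_p}(D_p, E_{R_p}(κ(p))). Furthermore, the flat dimension of Hom_R(D, E_R(R/p)) over R is at most ht(p). -/

import Mathlib

/-!
Common definitions: property t(p), injective hulls, (C-)Gorenstein injective modules,
(C-)Gorenstein injective / injective / flat dimensions, small support, torsion functor,
Tor and Ext modules, semidualizing and dualizing modules, depth, Cohen-Macaulay rings,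
Serre's condition (S₁), Gorenstein local rings, minimal injective resolutions.
-/

universe u

open CategoryTheory Limits DirectSum

noncomputable section

/-- An `R`-module `S` has property `t(p)`: multiplication by every `r ∉ p` is bijective on `S`,
and every element of `S` is annihilated by a power of `p`. -/
def PropT (R : Type u) [CommRing R] (p : Ideal R) (S : Type u) [AddCommGroup S]
    [Module R S] : Prop :=
  (∀ r : R, r ∉ p → Function.Bijective (fun s : S => r • s)) ∧
  (∀ x : S, ∃ m : ℕ, 0 < m ∧ ∀ a ∈ p ^ m, a • x = 0)

/-- `E` is an injective hull of `N` over `R`: `E` is injective and `N` embeds in `E` as an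
essential submodule. -/
def IsInjectiveHull (R : Type u) [CommRing R] (N : Type u) [AddCommGroup N] [Module R N]
    (E : Type u) [AddCommGroup E] [Module R E] : Prop :=
  Module.Injective R E ∧ ∃ ι : N →ₗ[R] E, Function.Injective ι ∧
    ∀ K : Submodule R E, K ≠ ⊥ → K ⊓ LinearMap.range ι ≠ ⊥

/-- A complete injective resolution: a doubly infinite exact sequence of injective modules
which stays exact after applying `Hom_R(-, I)` for every injective module `I`. -/
structure CompleteInjRes (R : Type u) [CommRing R] where
  E : ℤ → Type u
  [acg : ∀ i, AddCommGroup (E i)]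
  [mod : ∀ i, Module R (E i)]
  d : ∀ i, E i →ₗ[R] E (i + 1)
  inj : ∀ i, Module.Injective R (E i)
  exct : ∀ i, LinearMap.range (d i) = LinearMap.ker (d (i + 1))
  homExact : ∀ (I : Type u) [AddCommGroup I] [Module R I], Module.Injective R I →
    ∀ (i : ℤ) (g : E (i + 1) →ₗ[R] I), g ∘ₗ d i = 0 →
      ∃ h : E (i + 1 + 1) →ₗ[R] I, h ∘ₗ d (i + 1) = g

attribute [instance] CompleteInjRes.acg CompleteInjRes.mod

/-- `G` is a Gorenstein injective `R`-module: it is the image of some map in a complete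
injective resolution. -/
def GorensteinInjective (R : Type u) [CommRing R] (G : Type u) [AddCommGroup G]
    [Module R G] : Prop :=
  ∃ X : CompleteInjRes R, Nonempty (G ≃ₗ[R] LinearMap.range (X.d 0))

/-- A complete `I_C I`-resolution: an exact sequence
`⋯ → Hom(C,I₁) → Hom(C,I₀) → I⁰ → I¹ → ⋯` (terms in nonnegative degrees are injective,
terms in negative degrees are of the form `Hom_R(C, I)` with `I` injective) such that
`Hom_R(Hom_R(C,J), -)` leaves it exact for every injective `R`-module `J`. -/
structure CompleteICIRes (R : Type u) [CommRing R] (C : Type u) [AddCommGroup C]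
    [Module R C] where
  X : ℤ → Type u
  [acg : ∀ i, AddCommGroup (X i)]
  [mod : ∀ i, Module R (X i)]
  d : ∀ i, X i →ₗ[R] X (i + 1)
  exct : ∀ i, LinearMap.range (d i) = LinearMap.ker (d (i + 1))
  injPos : ∀ i : ℤ, 0 ≤ i → Module.Injective R (X i)
  homCInjNeg : ∀ i : ℤ, i < 0 → ∃ (I : Type u) (_ : AddCommGroup I) (_ : Module R I),
    Module.Injective R I ∧ Nonempty (X i ≃ₗ[R] (C →ₗ[R] I))
  homExact : ∀ (J : Type u) [AddCommGroup J] [Module R J], Module.Injective R J →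
    ∀ (i : ℤ) (g : (C →ₗ[R] J) →ₗ[R] X (i + 1)), d (i + 1) ∘ₗ g = 0 →
      ∃ h : (C →ₗ[R] J) →ₗ[R] X i, d i ∘ₗ h = g

attribute [instance] CompleteICIRes.acg CompleteICIRes.mod

/-- `G` is a `C`-Gorenstein injective `R`-module: it is the image of the map
`Hom_R(C, I₀) → I⁰` in some complete `I_C I`-resolution. -/
def CGorensteinInjective (R : Type u) [CommRing R] (C : Type u) [AddCommGroup C] [Module R C]
    (G : Type u) [AddCommGroup G] [Module R G] : Prop :=
  ∃ X : CompleteICIRes R C, Nonempty (G ≃ₗ[R] LinearMap.range (X.d (-1)))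

/-- `M` has a `C`-Gorenstein injective coresolution `0 → M → G⁰ → ⋯ → Gⁿ → 0`,
i.e. `C`-Gorenstein injective dimension at most `n`. -/
def CGidLE (R : Type u) [CommRing R] (C : Type u) [AddCommGroup C] [Module R C] :
    ℕ → ModuleCat.{u} R → Prop
  | 0, M => CGorensteinInjective R C M
  | n + 1, M => ∃ (G : ModuleCat.{u} R), CGorensteinInjective R C G ∧
      ∃ ι : M →ₗ[R] G, Function.Injective ι ∧
        CGidLE R C n (ModuleCat.of R (G ⧸ LinearMap.range ι))

/-- The `C`-Gorenstein injective dimension of `M` (equal to `⊤` if `M` admits no bounded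
coresolution by `C`-Gorenstein injective modules). -/
def CGid (R : Type u) [CommRing R] (C : Type u) [AddCommGroup C] [Module R C]
    (M : Type u) [AddCommGroup M] [Module R M] : ℕ∞ :=
  sInf {n : ℕ∞ | ∃ m : ℕ, (m : ℕ∞) = n ∧ CGidLE R C m (ModuleCat.of R M)}

/-- There exists an exact sequence `0 → N → Gₙ → ⋯ → G₁ → M → 0` in which each `Gᵢ` is
`C`-Gorenstein injective (and `N` is arbitrary). -/
def CGICoresApprox (R : Type u) [CommRing R] (C : Type u) [AddCommGroup C] [Module R C] :
    ℕ → ModuleCat.{u} R → Prop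
  | 0, _ => True
  | n + 1, M => ∃ (G : ModuleCat.{u} R), CGorensteinInjective R C G ∧
      ∃ π : G →ₗ[R] M, Function.Surjective π ∧
        CGICoresApprox R C n (ModuleCat.of R (LinearMap.ker π))

/-- The `a`-torsion submodule `Γ_a(N)` of `N`. -/
def torsionSubmodule (R : Type u) [CommRing R] (a : Ideal R) (N : Type u) [AddCommGroup N]
    [Module R N] : Submodule R N :=
  ⨆ m : ℕ, Submodule.torsionBySet R N ((a ^ m : Ideal R) : Set R)

/-- `Tor_i^R(M, N)`, as an object of `ModuleCat R`. -/
abbrev TorM (R : Type u) [CommRing R] (i : ℕ) (M N : Type u) [AddCommGroup M] [Module R M]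
    [AddCommGroup N] [Module R N] : ModuleCat.{u} R :=
  ((Tor (ModuleCat.{u} R) i).obj (ModuleCat.of R M)).obj (ModuleCat.of R N)

/-- `Ext_R^i(M, N)`, as an object of `ModuleCat R`. -/
abbrev ExtM (R : Type u) [CommRing R] (i : ℕ) (M N : Type u) [AddCommGroup M] [Module R M]
    [AddCommGroup N] [Module R N] : ModuleCat.{u} R :=
  ((Ext R (ModuleCat.{u} R) i).obj (Opposite.op (ModuleCat.of R M))).obj (ModuleCat.of R N)

/-- The small support of `M`: primes `p` such that `Tor_i^R(κ(p), M) ≠ 0` for some `i`,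
where `κ(p)` is the residue field of `R_p`. -/
def smallSupport (R : Type u) [CommRing R] (M : Type u) [AddCommGroup M] [Module R M] :
    Set (PrimeSpectrum R) :=
  {p | ∃ i : ℕ,
    Nontrivial (TorM R i (IsLocalRing.ResidueField (Localization.AtPrime p.asIdeal)) M)}

/-- `C` is a semidualizing `R`-module: finitely generated, the homothety map
`R → Hom_R(C,C)` is bijective, and `Ext_R^i(C,C) = 0` for `i ≥ 1`. -/
def IsSemidualizing (R : Type u) [CommRing R] (C : Type u) [AddCommGroup C] [Module R C] : Prop :=
  Module.Finite R C ∧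
  Function.Bijective (fun r : R => (r • LinearMap.id : C →ₗ[R] C)) ∧
  ∀ i : ℕ, 1 ≤ i → Subsingleton (ExtM R i C C)

/-- `M` has injective dimension at most `n`. -/
def InjDimLE (R : Type u) [CommRing R] : ℕ → ModuleCat.{u} R → Prop
  | 0, M => Module.Injective R M
  | n + 1, M => ∃ (I : ModuleCat.{u} R), Module.Injective R I ∧
      ∃ ι : M →ₗ[R] I, Function.Injective ι ∧
        InjDimLE R n (ModuleCat.of R (I ⧸ LinearMap.range ι))

/-- `M` has flat dimension at most `n`. -/
def FlatDimLE (R : Type u) [CommRing R] : ℕ → ModuleCat.{u} R → Prop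
  | 0, M => Module.Flat R M
  | n + 1, M => ∃ (F : ModuleCat.{u} R), Module.Flat R F ∧
      ∃ π : F →ₗ[R] M, Function.Surjective π ∧
        FlatDimLE R n (ModuleCat.of R (LinearMap.ker π))

/-- `D` is a dualizing `R`-module: semidualizing of finite injective dimension. -/
def IsDualizing (R : Type u) [CommRing R] (D : Type u) [AddCommGroup D] [Module R D] : Prop :=
  IsSemidualizing R D ∧ ∃ n : ℕ, InjDimLE R n (ModuleCat.of R D)

/-- The depth of a local ring: the supremum of lengths of regular sequences contained in
the maximal ideal. -/
def localRingDepth (A : Type u) [CommRing A] [IsLocalRing A] : ℕ∞ :=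
  sSup {n : ℕ∞ | ∃ rs : List A, (∀ r ∈ rs, r ∈ IsLocalRing.maximalIdeal A) ∧
    RingTheory.Sequence.IsRegular A rs ∧ (rs.length : ℕ∞) = n}

/-- `R` is a Cohen-Macaulay ring: for each prime `p`, `depth (R_p) = dim (R_p)`. -/
def IsCohenMacaulayRing (R : Type u) [CommRing R] : Prop :=
  ∀ (p : Ideal R) (_ : p.IsPrime),
    (localRingDepth (Localization.AtPrime p) : WithBot ℕ∞) =
      ringKrullDim (Localization.AtPrime p)

/-- Serre's condition `(S₁)`: `depth (R_p) ≥ min (ht p, 1)` for every prime `p`. -/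
def SerreS1 (R : Type u) [CommRing R] : Prop :=
  ∀ (p : Ideal R) (hp : p.IsPrime),
    min (Order.height (⟨p, hp⟩ : PrimeSpectrum R)) 1 ≤ localRingDepth (Localization.AtPrime p)

/-- A Gorenstein local ring: a noetherian local ring of finite self-injective dimension. -/
def IsGorensteinLocalRing (A : Type u) [CommRing A] : Prop :=
  IsLocalRing A ∧ IsNoetherianRing A ∧ ∃ n : ℕ, InjDimLE A n (ModuleCat.of A A)

/-- A minimal injective resolution `0 → D → J⁰ → J¹ → ⋯` of `D`: an exact sequence with all
`Jⁱ` injective, in which the kernel of each differential is an essential submodule. -/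
structure MinimalInjRes (R : Type u) [CommRing R] (D : Type u) [AddCommGroup D]
    [Module R D] where
  J : ℕ → Type u
  [acg : ∀ i, AddCommGroup (J i)]
  [mod : ∀ i, Module R (J i)]
  ε : D →ₗ[R] J 0
  d : ∀ i, J i →ₗ[R] J (i + 1)
  inj : ∀ i, Module.Injective R (J i)
  ε_inj : Function.Injective ε
  exct0 : LinearMap.range ε = LinearMap.ker (d 0)
  exct : ∀ i, LinearMap.range (d i) = LinearMap.ker (d (i + 1))
  minimal : ∀ i, ∀ K : Submodule R (J i), K ≠ ⊥ → K ⊓ LinearMap.ker (d i) ≠ ⊥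

attribute [instance] MinimalInjRes.acg MinimalInjRes.mod

end

section ExtTorsion

variable {R : Type u} [CommRing R]

/-- `Ext_R^i(N, M)` vanishes after localization at the prime `p`, phrased elementwise. -/
def ExtTorsion (p : Ideal R) (N M : Type u) [AddCommGroup N] [Module R N] [AddCommGroup M]
    [Module R M] (i : ℕ) : Prop :=
  ∀ x : Abelian.Ext (ModuleCat.of R N) (ModuleCat.of R M) i, ∃ s : R, s ∉ p ∧ s • x = 0

variable {p : Ideal R} {N N₁ N₂ N₃ M : Type u} [AddCommGroup N] [Module R N] [AddCommGroup N₁]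
  [Module R N₁] [AddCommGroup N₂] [Module R N₂] [AddCommGroup N₃] [Module R N₃]
  [AddCommGroup M] [Module R M]

theorem moduleCat_shortExact_of_exact {f : N₁ →ₗ[R] N₂} {g : N₂ →ₗ[R] N₃}
    (hf : Function.Injective f) (hg : Function.Surjective g) (hfg : Function.Exact f g) :
    (ModuleCat.shortComplexOfCompEqZero f g hfg.linearMap_comp_eq_zero).ShortExact :=
  ModuleCat.shortComplex_shortExact _ hfg hf hg

theorem ExtTorsion.of_subsingleton (hp : p ≠ ⊤) {i : ℕ}
    (h : Subsingleton (Abelian.Ext (ModuleCat.of R N) (ModuleCat.of R M) i)) :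
    ExtTorsion p N M i :=
  fun _ => ⟨1, (Ideal.ne_top_iff_one p).1 hp, Subsingleton.elim _ _⟩

theorem Ext.smul_eq_zero_of_smul_left_eq_zero {s : R} (hs : ∀ x : N, s • x = 0) {i : ℕ}
    (x : Abelian.Ext (ModuleCat.of R N) (ModuleCat.of R M) i) : s • x = 0 := by
  have h0 : s • 𝟙 (ModuleCat.of R N) = 0 := ModuleCat.hom_ext (LinearMap.ext hs)
  have : s • x = (Abelian.Ext.mk₀ (s • 𝟙 (ModuleCat.of R N))).comp x (zero_add i) := by
    simp [Abelian.Ext.mk₀_smul]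
  rw [this, h0, Abelian.Ext.mk₀_zero, Abelian.Ext.zero_comp]

theorem ExtTorsion.of_smul_eq_zero {s : R} (hsp : s ∉ p) (hs : ∀ x : N, s • x = 0) (i : ℕ) :
    ExtTorsion p N M i :=
  fun x => ⟨s, hsp, Ext.smul_eq_zero_of_smul_left_eq_zero hs x⟩

theorem ExtTorsion.middle [p.IsPrime] {f : N₁ →ₗ[R] N₂} {g : N₂ →ₗ[R] N₃}
    (hf : Function.Injective f) (hg : Function.Surjective g) (hfg : Function.Exact f g) {i : ℕ}
    (h₁ : ExtTorsion p N₁ M i) (h₃ : ExtTorsion p N₃ M i) : ExtTorsion p N₂ M i := by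
  intro x
  have S := moduleCat_shortExact_of_exact hf hg hfg
  obtain ⟨s, hs, hs0⟩ := h₁ ((Abelian.Ext.mk₀ (ModuleCat.ofHom f)).comp x (zero_add i))
  rw [← Abelian.Ext.comp_smul] at hs0
  obtain ⟨y, hy⟩ := Abelian.Ext.contravariant_sequence_exact₂ S _ (s • x) hs0
  obtain ⟨t, ht, ht0⟩ := h₃ y
  refine ⟨t * s, Ideal.IsPrime.mul_notMem ‹_› ht hs, ?_⟩
  rw [mul_smul, ← hy]
  erw [← Abelian.Ext.comp_smul, ht0, Abelian.Ext.comp_zero]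

theorem ExtTorsion.left [p.IsPrime] {f : N₁ →ₗ[R] N₂} {g : N₂ →ₗ[R] N₃}
    (hf : Function.Injective f) (hg : Function.Surjective g) (hfg : Function.Exact f g) {i : ℕ}
    (h₂ : ExtTorsion p N₂ M i) (h₃ : ExtTorsion p N₃ M (i + 1)) : ExtTorsion p N₁ M i := by
  intro x
  have S := moduleCat_shortExact_of_exact hf hg hfg
  obtain ⟨s, hs, hs0⟩ := h₃ (S.extClass.comp x (add_comm 1 i))
  rw [← Abelian.Ext.comp_smul] at hs0
  obtain ⟨y, hy⟩ := Abelian.Ext.contravariant_sequence_exact₁ S _ (s • x) (add_comm 1 i) hs0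
  obtain ⟨t, ht, ht0⟩ := h₂ y
  refine ⟨t * s, Ideal.IsPrime.mul_notMem ‹_› ht hs, ?_⟩
  rw [mul_smul, ← hy]
  erw [← Abelian.Ext.comp_smul, ht0, Abelian.Ext.comp_zero]

theorem ExtTorsion.right [p.IsPrime] {f : N₁ →ₗ[R] N₂} {g : N₂ →ₗ[R] N₃}
    (hf : Function.Injective f) (hg : Function.Surjective g) (hfg : Function.Exact f g) {i : ℕ}
    (h₁ : ExtTorsion p N₁ M i) (h₂ : ExtTorsion p N₂ M (i + 1)) :
    ExtTorsion p N₃ M (i + 1) := by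
  intro x
  have S := moduleCat_shortExact_of_exact hf hg hfg
  obtain ⟨s, hs, hs0⟩ := h₂ ((Abelian.Ext.mk₀ (ModuleCat.ofHom g)).comp x (zero_add _))
  rw [← Abelian.Ext.comp_smul] at hs0
  obtain ⟨y, hy⟩ := Abelian.Ext.contravariant_sequence_exact₃ S _ (s • x) hs0 (add_comm 1 i)
  obtain ⟨t, ht, ht0⟩ := h₁ y
  refine ⟨t * s, Ideal.IsPrime.mul_notMem ‹_› ht hs, ?_⟩
  rw [mul_smul, ← hy]
  erw [← Abelian.Ext.comp_smul, ht0, Abelian.Ext.comp_zero]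

/-- If multiplication by `a ∈ p` is injective on `N` and `Ext^{i+1}(N/aN, M)_p = 0`, then
`Ext^i(N, M)_p = 0` by Nakayama's lemma. -/
theorem ExtTorsion.of_injective_smul [IsNoetherianRing R] [hp : p.IsPrime] [Module.Finite R N]
    [Module.Finite R M] {a : R} (ha : a ∈ p)
    (hinj : Function.Injective (LinearMap.lsmul R N a)) {i : ℕ}
    (h : ExtTorsion p (N ⧸ LinearMap.range (LinearMap.lsmul R N a)) M (i + 1)) :
    ExtTorsion p N M i := by
  have S := moduleCat_shortExact_of_exact hinj (Submodule.mkQ_surjective _)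
    (LinearMap.exact_map_mkQ_range _)
  let X := Abelian.Ext (ModuleCat.of R N) (ModuleCat.of R M) i
  have hdiv : ∀ x : X, ∃ s ∉ p, ∃ y : X, s • x = a • y := by
    intro x
    obtain ⟨s, hs, hs0⟩ := h (S.extClass.comp x (add_comm 1 i))
    rw [← Abelian.Ext.comp_smul] at hs0
    obtain ⟨y, hy⟩ := Abelian.Ext.contravariant_sequence_exact₁ S _ (s • x) (add_comm 1 i) hs0
    refine ⟨s, hs, y, ?_⟩
    rw [← hy]
    have : ModuleCat.ofHom (LinearMap.lsmul R N a) = a • 𝟙 (ModuleCat.of R N) := rfl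
    change (Abelian.Ext.mk₀ (ModuleCat.ofHom (LinearMap.lsmul R N a))).comp y (zero_add i) = _
    rw [this]
    simp [Abelian.Ext.mk₀_smul]
  have hfin : Module.Finite R X := inferInstance
  obtain ⟨T, hT⟩ := hfin.fg_top
  choose s hs y hy using hdiv
  have hu : ∏ x ∈ T, s x ∉ p := by
    rw [hp.prod_mem_iff]
    rintro ⟨x, -, hx⟩
    exact hs x hx
  have hrange : LinearMap.range (LinearMap.lsmul R X (∏ x ∈ T, s x)) ≤ p • ⊤ := by
    rw [LinearMap.range_eq_map, ← hT, Submodule.map_span_le]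
    intro x hx
    obtain ⟨c, hc⟩ := Finset.dvd_prod_of_mem s hx
    rw [LinearMap.lsmul_apply, hc, mul_comm, mul_smul, hy, smul_comm, hT]
    exact Submodule.smul_mem_smul ha trivial
  obtain ⟨P, hmonic, -, hcoeff, hP⟩ :=
    LinearMap.exists_monic_and_natDegree_eq_and_coeff_mem_pow_and_aeval_eq_zero R
      (LinearMap.lsmul R X (∏ x ∈ T, s x)) p hrange
  set u := ∏ x ∈ T, s x
  refine fun x => ⟨P.eval u, fun hmem => ?_, ?_⟩
  · rw [Polynomial.eval_eq_sum_range, Finset.sum_range_succ, hmonic.coeff_natDegree, one_mul,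
      Ideal.add_mem_iff_right] at hmem
    · exact hu (hp.mem_of_pow_mem _ hmem)
    · refine Ideal.sum_mem _ fun k hk => Ideal.mul_mem_right _ _ ?_
      exact Ideal.pow_le_self (by have := Finset.mem_range.1 hk; omega) (hcoeff k)
  · have h1 : LinearMap.lsmul R X u = algebraMap R (Module.End R X) u := rfl
    rw [h1, Polynomial.aeval_algebraMap_apply] at hP
    exact DFunLike.congr_fun hP x

/-- If the kernel of multiplication by `a` on `N` vanishes locally at `p`, then locally vanishing
of `Ext(N, M)` above degree `t` passes to `N/aN` above degree `t + 1`. -/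
theorem ExtTorsion.quotient_smul [hp : p.IsPrime] {a s : R} (hs : s ∉ p)
    (hker : ∀ x : N, a • x = 0 → s • x = 0) {i : ℕ}
    (h₁ : ExtTorsion p N M (i + 1)) (h₂ : ExtTorsion p N M (i + 2)) :
    ExtTorsion p (N ⧸ LinearMap.range (LinearMap.lsmul R N a)) M (i + 2) := by
  have hr : ExtTorsion p (LinearMap.range (LinearMap.lsmul R N a)) M (i + 1) :=
    ExtTorsion.right (LinearMap.ker (LinearMap.lsmul R N a)).injective_subtype
      (LinearMap.surjective_rangeRestrict _)
      (LinearMap.exact_iff.2 <| by simp)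
      (ExtTorsion.of_smul_eq_zero hs (fun x => Subtype.ext (hker x.1 x.2)) i) h₁
  exact ExtTorsion.right (Submodule.injective_subtype _) (Submodule.mkQ_surjective _)
    (LinearMap.exact_iff.2 <| by simp) hr h₂

end ExtTorsion

section ExtVanishing

open scoped Pointwise

theorem InjDimLE.subsingleton_ext {R : Type u} [CommRing R] {n : ℕ} {Y : ModuleCat.{u} R}
    (h : InjDimLE R n Y) (X : ModuleCat.{u} R) {i : ℕ} (hi : n < i) : Subsingleton (Abelian.Ext X Y i) := by
  induction n generalizing Y i with
  | zero =>
    have : Module.Injective R Y := h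
    have : Injective Y := (Module.injective_iff_injective_object R Y).1 this
    obtain ⟨i, rfl⟩ := Nat.exists_eq_succ_of_ne_zero hi.ne'
    exact Abelian.Ext.subsingleton_of_injective _ _ i
  | succ n ih =>
    obtain ⟨I, hI, ι, hι, hQ⟩ := h
    have : Injective I := (Module.injective_iff_injective_object R I).1 hI
    obtain ⟨i, rfl⟩ := Nat.exists_eq_succ_of_ne_zero (Nat.zero_lt_of_lt hi).ne'
    have S := moduleCat_shortExact_of_exact hι (Submodule.mkQ_surjective _)
      (LinearMap.exact_map_mkQ_range ι)
    have := ih hQ (i := i) (by omega)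
    refine subsingleton_of_forall_eq 0 fun x => ?_
    obtain ⟨y, rfl⟩ := Abelian.Ext.covariant_sequence_exact₁ X S x
      (haveI : Subsingleton (Abelian.Ext X I (i + 1)) := Abelian.Ext.subsingleton_of_injective _ _ i
       Subsingleton.elim _ _) rfl
    rw [Subsingleton.elim y 0, Abelian.Ext.zero_comp]

variable {R : Type u} [CommRing R] [IsNoetherianRing R] {p : Ideal R} [hp : p.IsPrime]
  {M : Type u} [AddCommGroup M] [Module R M]

theorem exists_le_mem_associatedPrimes {N : Type u} [AddCommGroup N] [Module R N]
    [Module.Finite R N] {q : Ideal R} [q.IsPrime] (h : Module.annihilator R N ≤ q) :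
    ∃ q' ∈ associatedPrimes R N, q' ≤ q := by
  obtain ⟨q', hq', hle⟩ := Ideal.exists_minimalPrimes_le h
  exact ⟨q', Module.associatedPrimes.minimalPrimes_annihilator_subset_associatedPrimes R N hq', hle⟩

/-- If `p` is not associated to `N`, some `x ∈ p` avoids all associated primes of `N` inside `p`,
and then multiplication by `x` is locally injective at `p`. -/
theorem exists_mem_forall_associatedPrimes_notMem (N : Type u) [AddCommGroup N] [Module R N]
    [Module.Finite R N] (hN : p ∉ associatedPrimes R N) :
    ∃ x ∈ p, (∀ q ∈ associatedPrimes R N, q ≤ p → x ∉ q) ∧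
      ∃ s ∉ p, ∀ y : N, x • y = 0 → s • y = 0 := by
  have hfin : {q ∈ associatedPrimes R N | q ≤ p}.Finite :=
    (associatedPrimes.finite R N).subset fun q hq => hq.1
  have havoid : ¬ ((p : Set R) ⊆ ⋃ q ∈ {q ∈ associatedPrimes R N | q ≤ p}, (q : Set R)) := by
    intro hsub
    obtain ⟨q, hq, hle⟩ := (Ideal.subset_union_prime_finite hfin (f := id) ⊤ ⊤
      fun q hq _ _ => hq.1.isPrime).1 hsub
    exact hN (le_antisymm hle hq.2 ▸ hq.1)
  obtain ⟨x, hxp, hx⟩ := Set.not_subset.1 havoid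
  have hx' : ∀ q ∈ associatedPrimes R N, q ≤ p → x ∉ q := fun q hq hle hxq =>
    hx (Set.mem_biUnion (show q ∈ {q ∈ associatedPrimes R N | q ≤ p} from ⟨hq, hle⟩) hxq)
  refine ⟨x, hxp, hx', ?_⟩
  let K := LinearMap.ker (LinearMap.lsmul R N x)
  have hK : ¬ Module.annihilator R K ≤ p := by
    intro hle
    obtain ⟨q, hq, hqp⟩ := exists_le_mem_associatedPrimes hle
    refine hx' q (associatedPrimes.subset_of_injective K.injective_subtype hq) hqp ?_
    refine hq.annihilator_le ?_
    rw [Submodule.mem_annihilator]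
    exact fun y _ => Subtype.ext y.2
  obtain ⟨s, hs, hsp⟩ := Set.not_subset.1 hK
  refine ⟨s, hsp, fun y hy => ?_⟩
  exact congrArg Subtype.val (Module.mem_annihilator.1 hs ⟨y, hy⟩)

/-- The key step for the residue field: cutting down a module `N` by elements that are regular
locally at `p` produces, after at most `ht p` steps, a module containing `R ⧸ p`. -/
theorem ExtTorsion.quotient_prime_of_height_le [Module.Finite R M] {h s : ℕ}
    (hh : (h : ℕ∞) = Order.height (⟨p, hp⟩ : PrimeSpectrum R)) (hhs : h ≤ s)
    (hvan : ∀ (N : Type u) [AddCommGroup N] [Module R N] [Module.Finite R N],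
      ExtTorsion p N M (s + 2))
    (k t : ℕ) (hkt : t + k = h) (N : Type u) [AddCommGroup N] [Module R N] [Module.Finite R N]
    (hN : ∀ i, t < i → ExtTorsion p N M i) (hNp : Module.annihilator R N ≤ p)
    (hNq : ∀ q : PrimeSpectrum R, Module.annihilator R N ≤ q.asIdeal → q.asIdeal ≤ p →
      (t : ℕ∞) ≤ Order.height q) :
    ExtTorsion p (R ⧸ p) M (s + 1) := by
  induction k using Nat.strong_induction_on generalizing t N with | _ k ih =>
  by_cases hass : p ∈ associatedPrimes R N
  · obtain ⟨-, f, hf⟩ := (isAssociatedPrime_iff_exists_injective_linearMap p N).1 hass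
    exact ExtTorsion.left hf (Submodule.mkQ_surjective _) (LinearMap.exact_map_mkQ_range f)
      (hN _ (by omega)) (hvan _)
  obtain ⟨x, hxp, hx, r, hr, hker⟩ := exists_mem_forall_associatedPrimes_notMem N hass
  let N' := N ⧸ LinearMap.range (LinearMap.lsmul R N x)
  have hann : Module.annihilator R N ≤ Module.annihilator R N' :=
    LinearMap.annihilator_le_of_surjective _ (Submodule.mkQ_surjective _)
  have hxann : x ∈ Module.annihilator R N' := by
    rw [Module.mem_annihilator]
    intro y
    obtain ⟨y, rfl⟩ := Submodule.mkQ_surjective _ y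
    exact (Submodule.Quotient.mk_eq_zero _).2 ⟨y, rfl⟩
  have hNp' : Module.annihilator R N' ≤ p := by
    have hmem : (⟨p, hp⟩ : PrimeSpectrum R) ∈ Module.support R (QuotSMulTop x N) := by
      rw [Module.support_quotSMulTop]
      exact ⟨Module.mem_support_iff_of_finite.2 hNp, by simpa using hxp⟩
    have hrange : LinearMap.range (LinearMap.lsmul R N x) = x • (⊤ : Submodule R N) := by
      ext y
      simp [Submodule.mem_smul_pointwise_iff_exists]
    have e : N' ≃ₗ[R] QuotSMulTop x N := Submodule.quotEquivOfEq _ _ hrange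
    rw [e.annihilator_eq]
    exact Module.mem_support_iff_of_finite.1 hmem
  have hNq' : ∀ q : PrimeSpectrum R, Module.annihilator R N' ≤ q.asIdeal → q.asIdeal ≤ p →
      ((t + 1 : ℕ) : ℕ∞) ≤ Order.height q := by
    intro q hq hqp
    obtain ⟨q', hq', hle⟩ := exists_le_mem_associatedPrimes (hann.trans hq)
    have hlt : (⟨q', hq'.isPrime⟩ : PrimeSpectrum R) < q :=
      lt_of_le_of_ne hle fun heq => hx q' hq' (hle.trans hqp)
        (by have := hq hxann; rwa [← heq] at this)
    refine le_trans ?_ (Order.height_add_one_le hlt)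
    push_cast
    gcongr
    exact hNq _ (fun r hr => hq'.annihilator_le (by rwa [Submodule.annihilator_top])) (hle.trans hqp)
  cases k with
  | zero =>
    have := hNq' ⟨p, hp⟩ hNp' le_rfl
    rw [← hh, Nat.cast_le] at this
    omega
  | succ k =>
    refine ih k (Nat.lt_succ_self k) (t + 1) (by omega) N' (fun i hi => ?_) hNp' hNq'
    obtain ⟨j, rfl⟩ : ∃ j, i = j + 2 := ⟨i - 2, by omega⟩
    exact ExtTorsion.quotient_smul hr hker (hN _ (by omega)) (hN _ (by omega))

/-- Descending step: if `Ext^i(N, M)_p = 0` for all finite `N` in degree `s + 2`, with `s ≥ ht p`,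
then the same holds in degree `s + 1`. -/
theorem ExtTorsion.of_succ [Module.Finite R M] {h s : ℕ}
    (hh : (h : ℕ∞) = Order.height (⟨p, hp⟩ : PrimeSpectrum R)) (hhs : h ≤ s)
    (hvan : ∀ (N : Type u) [AddCommGroup N] [Module R N] [Module.Finite R N],
      ExtTorsion p N M (s + 2))
    (N : Type u) [AddCommGroup N] [Module R N] [Module.Finite R N] :
    ExtTorsion p N M (s + 1) := by
  induction ‹Module.Finite R N› using
    IsNoetherianRing.induction_on_isQuotientEquivQuotientPrime R with
  | subsingleton N =>
    exact ExtTorsion.of_smul_eq_zero ((Ideal.ne_top_iff_one p).1 hp.ne_top)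
      (fun x => Subsingleton.elim _ _) _
  | quotient N q e =>
    refine ExtTorsion.left (f := e.toLinearMap) (g := (0 : (R ⧸ q.asIdeal) →ₗ[R] PUnit.{u + 1}))
      e.injective (Function.surjective_to_subsingleton _) ?_ ?_ (hvan _)
    · intro y
      exact ⟨fun _ => e.surjective y, fun _ => rfl⟩
    by_cases hqp : q.asIdeal ≤ p
    · rcases hqp.eq_or_lt with heq | hlt
      · rw [heq]
        refine ExtTorsion.quotient_prime_of_height_le hh hhs hvan h 0 (zero_add h) R
          (fun i hi => ?_) ?_ (fun _ _ _ => zero_le)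
        · obtain ⟨i, rfl⟩ := Nat.exists_eq_succ_of_ne_zero hi.ne'
          have : Projective (ModuleCat.of R R) :=
            (IsProjective.iff_projective R).1 inferInstance
          exact ExtTorsion.of_subsingleton hp.ne_top
            (Abelian.Ext.subsingleton_of_projective _ _ i)
        · intro r hr
          have : r • (1 : R) = 0 := Module.mem_annihilator.1 hr 1
          simp_all
      · obtain ⟨a, hap, haq⟩ := Set.exists_of_ssubset hlt
        refine ExtTorsion.of_injective_smul hap ?_ (hvan _)
        rw [injective_iff_map_eq_zero]
        intro y hy
        obtain ⟨y, rfl⟩ := Ideal.Quotient.mk_surjective y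
        have hy : Ideal.Quotient.mk q.asIdeal (a * y) = 0 := hy
        rw [Ideal.Quotient.eq_zero_iff_mem] at hy ⊢
        exact (q.isPrime.mem_or_mem hy).resolve_left haq
    · obtain ⟨a, haq, hap⟩ := Set.not_subset.1 hqp
      refine ExtTorsion.of_smul_eq_zero hap (fun y => ?_) _
      obtain ⟨y, rfl⟩ := Ideal.Quotient.mk_surjective y
      exact Ideal.Quotient.eq_zero_iff_mem.2 (q.asIdeal.mul_mem_right y haq)
  | exact N₁ N₂ N₃ f g hf hg hfg h₁ h₃ => exact ExtTorsion.middle hf hg hfg h₁ h₃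

/-- A finite module of finite injective dimension has injective dimension at most `ht p` locally
at `p`. -/
theorem ExtTorsion.of_injDimLE [Module.Finite R M] {n h : ℕ} (hM : InjDimLE R n (ModuleCat.of R M))
    (hh : (h : ℕ∞) = Order.height (⟨p, hp⟩ : PrimeSpectrum R))
    (N : Type u) [AddCommGroup N] [Module R N] [Module.Finite R N] :
    ExtTorsion p N M (h + 1) := by
  suffices ∀ k j, h ≤ j → n ≤ j + k → ∀ (N : Type u) [AddCommGroup N] [Module R N]
      [Module.Finite R N], ExtTorsion p N M (j + 1) from this n h le_rfl (by omega) N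
  intro k
  induction k with
  | zero =>
    intro j _ hnj N _ _ _
    exact ExtTorsion.of_subsingleton hp.ne_top (hM.subsingleton_ext _ (by omega))
  | succ k ih =>
    intro j hhj hnj N _ _ _
    exact ExtTorsion.of_succ hh hhj (ih (j + 1) (by omega) (by omega)) N

end ExtVanishing

section HomIntoInjective

variable {R : Type u} [CommRing R] {p : Ideal R} {M E : Type u} [AddCommGroup M] [Module R M]
  [AddCommGroup E] [Module R E]

theorem ExtTorsion.exists_smul_extension {a : Ideal R} (h : ExtTorsion p (R ⧸ a) M 1)
    (g : a →ₗ[R] M) : ∃ s ∉ p, ∃ w : M, ∀ x : a, s • g x = x.1 • w := by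
  have S := moduleCat_shortExact_of_exact (f := a.subtype) (g := a.mkQ)
    (Submodule.injective_subtype a) (Submodule.mkQ_surjective a)
    (LinearMap.exact_subtype_mkQ a)
  obtain ⟨s, hs, hs0⟩ := h (S.extClass.comp (Abelian.Ext.mk₀ (ModuleCat.ofHom g)) (add_zero 1))
  rw [← Abelian.Ext.comp_smul] at hs0
  obtain ⟨y, hy⟩ := Abelian.Ext.contravariant_sequence_exact₁ S _ _ (add_zero 1) hs0
  obtain ⟨k, rfl⟩ := (Abelian.Ext.mk₀_bijective _ _).2 y
  rw [Abelian.Ext.mk₀_comp_mk₀, ← Abelian.Ext.mk₀_smul] at hy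
  have hy := (Abelian.Ext.mk₀_bijective _ _).1 hy
  refine ⟨s, hs, k.hom (1 : R), fun x => ?_⟩
  have h1 : k.hom x.1 = s • g x := DFunLike.congr_fun (congrArg ModuleCat.Hom.hom hy) x
  rw [← h1]
  have h2 := k.hom.map_smul x.1 (1 : R)
  rw [← h2]
  simp

/-- If `Ext^1(R/a, M)_p = 0` for every ideal `a` and `E` is an injective module on which elements
outside `p` act injectively, then `Hom(M, E)` is flat. -/
theorem ExtTorsion.flat_hom [IsNoetherianRing R] (hE : Module.Injective R E)
    (hpE : ∀ s ∉ p, ∀ x : E, s • x = 0 → x = 0)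
    (h : ∀ a : Ideal R, ExtTorsion p (R ⧸ a) M 1) : Module.Flat R (M →ₗ[R] E) := by
  rw [Module.Flat.iff_forall_isTrivialRelation]
  intro l f φ hφ
  let F : (Fin l → R) →ₗ[R] R := Fintype.linearCombination R f
  obtain ⟨k, a, ha⟩ := Submodule.fg_iff_exists_fin_generating_family.1
    (IsNoetherian.noetherian (LinearMap.ker F))
  let A : (Fin l → M) →ₗ[R] (Fin k → M) :=
    LinearMap.pi fun j => ∑ i, a j i • LinearMap.proj i
  let Φ : (Fin l → M) →ₗ[R] E := ∑ i, φ i ∘ₗ LinearMap.proj i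
  have hA : ∀ z j, A z j = ∑ i, a j i • z i := by simp [A]
  have hΦ : ∀ z, Φ z = ∑ i, φ i (z i) := by simp [Φ]
  have hker : LinearMap.ker A ≤ LinearMap.ker Φ := by
    intro z hz
    let Z : (Fin l → R) →ₗ[R] M := Fintype.linearCombination R z
    have hZ : LinearMap.ker F ≤ LinearMap.ker Z := by
      rw [← ha, Submodule.span_le]
      rintro _ ⟨j, rfl⟩
      have := congrFun (LinearMap.mem_ker.1 hz) j
      rw [hA] at this
      simpa [Z, Fintype.linearCombination_apply] using this
    obtain ⟨s, hs, w, hw⟩ := (h (LinearMap.range F)).exists_smul_extension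
      ((LinearMap.ker F).liftQ Z hZ ∘ₗ F.quotKerEquivRange.symm.toLinearMap)
    have hsz : ∀ i, s • z i = f i • w := by
      intro i
      have := hw ⟨F (Pi.single i 1), LinearMap.mem_range_self _ _⟩
      rw [LinearMap.comp_apply, LinearEquiv.coe_coe, LinearMap.quotKerEquivRange_symm_apply_image,
        Submodule.mkQ_apply, Submodule.liftQ_apply] at this
      simpa [Z, F, Fintype.linearCombination_apply_single] using this
    refine hpE s hs _ ?_
    rw [← map_smul, hΦ]
    have := DFunLike.congr_fun hφ w
    simpa [hsz] using this
  obtain ⟨ψ, hψ⟩ := hE.out (LinearMap.range A).subtype (Submodule.injective_subtype _)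
    ((LinearMap.ker A).liftQ Φ hker ∘ₗ A.quotKerEquivRange.symm.toLinearMap)
  have hψA : ∀ z, ψ (A z) = Φ z := by
    intro z
    have := hψ ⟨A z, LinearMap.mem_range_self _ _⟩
    rwa [LinearMap.comp_apply, LinearEquiv.coe_coe, LinearMap.quotKerEquivRange_symm_apply_image,
      Submodule.mkQ_apply, Submodule.liftQ_apply] at this
  refine ⟨k, fun i j => a j i, fun j => ψ ∘ₗ LinearMap.single R (fun _ => M) j, fun i => ?_,
    fun j => ?_⟩
  · ext m
    have h1 : Φ (Pi.single i m) = φ i m := by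
      rw [hΦ, Finset.sum_eq_single i] <;> simp +contextual
    have h2 : A (Pi.single i m) = ∑ j, Pi.single j (a j i • m) := by
      ext j
      rw [hA, Finset.sum_eq_single i] <;> simp +contextual [Pi.single_apply]
    rw [← h1, ← hψA, h2]
    simp only [map_sum, LinearMap.sum_apply, LinearMap.smul_apply, LinearMap.comp_apply,
      LinearMap.single_apply]
    refine Finset.sum_congr rfl fun j _ => ?_
    rw [← map_smul, ← Pi.single_smul]
  · have : a j ∈ LinearMap.ker F := ha ▸ Submodule.subset_span ⟨j, rfl⟩
    simpa [F, Fintype.linearCombination_apply, mul_comm] using LinearMap.mem_ker.1 this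

theorem FlatDimLE.of_linearEquiv {n : ℕ} {X Y : ModuleCat.{u} R} (e : X ≃ₗ[R] Y)
    (h : FlatDimLE R n X) : FlatDimLE R n Y := by
  cases n with
  | zero =>
    have : Module.Flat R X := h
    exact Module.Flat.of_linearEquiv e.symm
  | succ n =>
    obtain ⟨F, hF, π, hπ, hk⟩ := h
    refine ⟨F, hF, e.toLinearMap ∘ₗ π, e.surjective.comp hπ, ?_⟩
    have : LinearMap.ker (e.toLinearMap ∘ₗ π) = LinearMap.ker π := LinearEquiv.ker_comp _ _
    rwa [this]

/-- Dimension shifting along an embedding of `M` into an injective module. -/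
theorem ExtTorsion.of_injective_quotient {N I : Type u} [AddCommGroup N] [Module R N]
    [AddCommGroup I] [Module R I] (hI : Module.Injective R I) {ι : M →ₗ[R] I}
    (hι : Function.Injective ι) {i : ℕ} (h : ExtTorsion p N M (i + 2)) :
    ExtTorsion p N (I ⧸ LinearMap.range ι) (i + 1) := by
  intro x
  have S := moduleCat_shortExact_of_exact hι (Submodule.mkQ_surjective _)
    (LinearMap.exact_map_mkQ_range ι)
  have : Injective (ModuleCat.of R I) := (Module.injective_iff_injective_object R I).1 hI
  obtain ⟨s, hs, hs0⟩ := h (x.comp S.extClass rfl)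
  rw [← Abelian.Ext.smul_comp] at hs0
  obtain ⟨y, hy⟩ := Abelian.Ext.covariant_sequence_exact₃ _ S _ rfl hs0
  have : Subsingleton (Abelian.Ext (ModuleCat.of R N) (ModuleCat.of R I) (i + 1)) :=
    Abelian.Ext.subsingleton_of_injective _ _ i
  refine ⟨s, hs, ?_⟩
  rw [← hy]
  have hy0 : y = 0 := this.elim y 0
  rw [hy0, Abelian.Ext.zero_comp]

theorem ExtTorsion.of_injective (hp : p ≠ ⊤) (hM : Module.Injective R M) (N : Type u)
    [AddCommGroup N] [Module R N] (i : ℕ) : ExtTorsion p N M (i + 1) :=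
  have : Injective (ModuleCat.of R M) := (Module.injective_iff_injective_object R M).1 hM
  ExtTorsion.of_subsingleton hp (Abelian.Ext.subsingleton_of_injective _ _ i)

theorem Module.Injective.lcomp_surjective (hE : Module.Injective R E) {N : Type u}
    [AddCommGroup N] [Module R N] {f : M →ₗ[R] N} (hf : Function.Injective f) :
    Function.Surjective (LinearMap.lcomp R E f) := fun g => by
  obtain ⟨k, hk⟩ := hE.out f hf g
  exact ⟨k, LinearMap.ext hk⟩

theorem Module.Injective.range_lcomp_eq_ker (hE : Module.Injective R E) {N P : Type u}
    [AddCommGroup N] [Module R N] [AddCommGroup P] [Module R P] {f : M →ₗ[R] N} {g : N →ₗ[R] P}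
    (h : LinearMap.range f = LinearMap.ker g) :
    LinearMap.range (LinearMap.lcomp R E g) = LinearMap.ker (LinearMap.lcomp R E f) := by
  ext k
  constructor
  · rintro ⟨k, rfl⟩
    ext x
    have : g (f x) = 0 := LinearMap.mem_ker.1 (h ▸ LinearMap.mem_range_self f x)
    simp [this]
  · intro hk
    have hle : LinearMap.ker g ≤ LinearMap.ker k := by
      rw [← h]
      rintro _ ⟨x, rfl⟩
      exact DFunLike.congr_fun (LinearMap.mem_ker.1 hk) x
    obtain ⟨ψ, hψ⟩ := hE.out (LinearMap.range g).subtype (Submodule.injective_subtype _)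
      ((LinearMap.ker g).liftQ k hle ∘ₗ g.quotKerEquivRange.symm.toLinearMap)
    refine ⟨ψ, LinearMap.ext fun z => ?_⟩
    have := hψ ⟨g z, LinearMap.mem_range_self _ _⟩
    rwa [LinearMap.comp_apply, LinearEquiv.coe_coe, LinearMap.quotKerEquivRange_symm_apply_image,
      Submodule.mkQ_apply, Submodule.liftQ_apply] at this

theorem ExtTorsion.flatDimLE_hom [IsNoetherianRing R] (hp : p ≠ ⊤) (hE : Module.Injective R E)
    (hpE : ∀ s ∉ p, ∀ x : E, s • x = 0 → x = 0) (n : ℕ)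
    (h : ∀ a : Ideal R, ExtTorsion p (R ⧸ a) M (n + 1)) :
    FlatDimLE R n (ModuleCat.of R (M →ₗ[R] E)) := by
  induction n generalizing M with
  | zero => exact ExtTorsion.flat_hom hE hpE h
  | succ n ih =>
    obtain ⟨I, hI, ι, hι⟩ : ∃ I : ModuleCat.{u} R, Module.Injective R I ∧
        ∃ ι : M →ₗ[R] I, Function.Injective ι := by
      obtain ⟨⟨I, hI, ι, hι⟩⟩ := EnoughInjectives.presentation (ModuleCat.of R M)
      exact ⟨I, (Module.injective_iff_injective_object R I).2 hI, ι.hom,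
        (ModuleCat.mono_iff_injective ι).1 hι⟩
    refine ⟨ModuleCat.of R (I →ₗ[R] E),
      ExtTorsion.flat_hom hE hpE fun a => ExtTorsion.of_injective hp hI _ 0,
      LinearMap.lcomp R E ι, hE.lcomp_surjective hι, ?_⟩
    refine FlatDimLE.of_linearEquiv ?_
      (ih fun a => ExtTorsion.of_injective_quotient hI hι (h a))
    refine LinearEquiv.trans (LinearEquiv.ofInjective (LinearMap.lcomp R E
      (LinearMap.range ι).mkQ) ?_) (LinearEquiv.ofEq _ _
        (hE.range_lcomp_eq_ker (Submodule.ker_mkQ _).symm))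
    intro f g hfg
    exact Submodule.linearMap_qext _ hfg

end HomIntoInjective

section Localization

variable {R : Type u} [CommRing R] {p : Ideal R} [hp : p.IsPrime]

theorem eq_zero_of_notMem_smul_eq_zero {E : Type u} [AddCommGroup E] [Module R E]
    [Module (Localization.AtPrime p) E] [IsScalarTower R (Localization.AtPrime p) E]
    {s : R} (hs : s ∉ p) {x : E} (h : s • x = 0) : x = 0 := by
  rw [← algebraMap_smul (Localization.AtPrime p)] at h
  exact (IsLocalization.map_units (Localization.AtPrime p)
    (⟨s, hs⟩ : p.primeCompl)).smul_eq_zero.1 h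

theorem Module.Injective.of_atPrime {E : Type u} [AddCommGroup E] [Module R E]
    [Module (Localization.AtPrime p) E] [IsScalarTower R (Localization.AtPrime p) E]
    (hE : Module.Injective R E) : Module.Injective (Localization.AtPrime p) E where
  out X Y _ _ _ _ f hf g := by
    let _ := Module.compHom X (algebraMap R (Localization.AtPrime p))
    let _ := Module.compHom Y (algebraMap R (Localization.AtPrime p))
    have : IsScalarTower R (Localization.AtPrime p) X :=
      IsScalarTower.of_algebraMap_smul fun _ _ => rfl
    have : IsScalarTower R (Localization.AtPrime p) Y :=
      IsScalarTower.of_algebraMap_smul fun _ _ => rfl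
    obtain ⟨k, hk⟩ := hE.out (f.restrictScalars R) hf (g.restrictScalars R)
    exact ⟨k.extendScalarsOfIsLocalization p.primeCompl (Localization.AtPrime p), hk⟩

/-- Injective hulls are unique up to isomorphism. -/
theorem IsInjectiveHull.nonempty_linearEquiv {N E E' : Type u} [AddCommGroup N] [Module R N]
    [AddCommGroup E] [Module R E] [AddCommGroup E'] [Module R E'] (hE : IsInjectiveHull R N E)
    (hE' : IsInjectiveHull R N E') : Nonempty (E ≃ₗ[R] E') := by
  obtain ⟨hE, ι, hι, hess⟩ := hE
  obtain ⟨hE', ι', hι', hess'⟩ := hE'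
  obtain ⟨f, hf⟩ := hE'.out ι hι ι'
  have hinj : Function.Injective f := by
    rw [← LinearMap.ker_eq_bot]
    by_contra hne
    refine hess _ hne ((Submodule.eq_bot_iff _).2 ?_)
    rintro _ ⟨hx, y, rfl⟩
    rw [SetLike.mem_coe, LinearMap.mem_ker, hf] at hx
    rw [(injective_iff_map_eq_zero ι').1 hι' y hx, map_zero]
  obtain ⟨r, hr⟩ := hE.out f hinj LinearMap.id
  have hrker : LinearMap.ker r = ⊥ := by
    by_contra hne
    refine hess' _ hne ((Submodule.eq_bot_iff _).2 ?_)
    rintro _ ⟨hx, y, rfl⟩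
    rw [SetLike.mem_coe, LinearMap.mem_ker, ← hf, hr, LinearMap.id_apply] at hx
    rw [← hf, hx, map_zero]
  refine ⟨LinearEquiv.ofBijective f ⟨hinj, fun y => ⟨r y, ?_⟩⟩⟩
  exact LinearMap.ker_eq_bot.1 hrker (hr (r y))

/-- An injective hull of `R ⧸ p` over `R` is an injective hull of the residue field over `R_p`. -/
theorem IsInjectiveHull.atPrime {E : Type u} [AddCommGroup E] [Module R E]
    [Module (Localization.AtPrime p) E] [IsScalarTower R (Localization.AtPrime p) E]
    (hE : IsInjectiveHull R (R ⧸ p) E) :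
    IsInjectiveHull (Localization.AtPrime p)
      (IsLocalRing.ResidueField (Localization.AtPrime p)) E := by
  obtain ⟨hE, ι, hι, hess⟩ := hE
  refine ⟨hE.of_atPrime, ?_⟩
  let A := Localization.AtPrime p
  let v : E := ι 1
  have hv : ∀ r : R, ι (Ideal.Quotient.mk p r) = r • v := fun r => by
    rw [← map_smul]
    congr 1
    exact (mul_one (Ideal.Quotient.mk p r)).symm
  have hpv : ∀ r ∈ p, r • v = 0 := fun r hr => by
    rw [← hv, Ideal.Quotient.eq_zero_iff_mem.2 hr, map_zero]
  have hmv : ∀ a : A, a • v = 0 ↔ a ∈ IsLocalRing.maximalIdeal A := by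
    intro a
    obtain ⟨⟨r, s⟩, rfl⟩ := IsLocalization.mk'_surjective p.primeCompl a
    rw [IsLocalization.AtPrime.mk'_mem_maximal_iff A p]
    constructor
    · intro h
      have h2 : r • v = 0 := by
        rw [← algebraMap_smul A, ← IsLocalization.mk'_spec' A r s, mul_smul, h, smul_zero]
      rw [← hv] at h2
      exact Ideal.Quotient.eq_zero_iff_mem.1 ((injective_iff_map_eq_zero ι).1 hι _ h2)
    · intro h
      refine eq_zero_of_notMem_smul_eq_zero s.2 ?_
      rw [← algebraMap_smul A, ← mul_smul, IsLocalization.mk'_spec', algebraMap_smul]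
      exact hpv r h
  let κ : IsLocalRing.ResidueField A →ₗ[A] E :=
    (IsLocalRing.maximalIdeal A).liftQ (LinearMap.toSpanSingleton A E v)
      fun a ha => (hmv a).2 ha
  have hκ : ∀ a : A, κ (IsLocalRing.residue A a) = a • v := fun a => rfl
  refine ⟨κ, ?_, fun K hK hbot => ?_⟩
  · rw [injective_iff_map_eq_zero]
    intro a ha
    obtain ⟨a, rfl⟩ := IsLocalRing.residue_surjective a
    rw [hκ, hmv] at ha
    exact (IsLocalRing.residue_eq_zero_iff a).2 ha
  · refine hess (K.restrictScalars R) (fun h => hK ?_) ((Submodule.eq_bot_iff _).2 ?_)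
    · exact (Submodule.restrictScalars_eq_bot_iff _ _ _).1 h
    rintro _ ⟨hx, y, rfl⟩
    obtain ⟨r, rfl⟩ := Ideal.Quotient.mk_surjective y
    refine (Submodule.eq_bot_iff _).1 hbot _ ⟨hx, IsLocalRing.residue A (algebraMap R A r), ?_⟩
    rw [hκ, hv, algebraMap_smul]

/-- `Hom_R(D, E) ≅ Hom_{R_p}(D_p, E)` for an `R_p`-module `E`. -/
theorem nonempty_hom_linearEquiv_localizedModule_hom (D E : Type u) [AddCommGroup D] [Module R D]
    [AddCommGroup E] [Module R E] [Module (Localization.AtPrime p) E]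
    [IsScalarTower R (Localization.AtPrime p) E] :
    Nonempty ((D →ₗ[R] E) ≃ₗ[Localization.AtPrime p]
      (LocalizedModule p.primeCompl D →ₗ[Localization.AtPrime p] E)) := by
  let A := Localization.AtPrime p
  have hunit : ∀ s : p.primeCompl, IsUnit ((algebraMap R (Module.End R E)) s) :=
    (isLocalizedModule_id p.primeCompl E A).map_units
  let L : (LocalizedModule p.primeCompl D →ₗ[A] E) →ₗ[A] (D →ₗ[R] E) :=
    { toFun := fun f => f.restrictScalars R ∘ₗ LocalizedModule.mkLinearMap p.primeCompl D
      map_add' := fun f g => rfl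
      map_smul' := fun a f => rfl }
  refine ⟨(LinearEquiv.ofBijective L ⟨fun f g hfg => ?_, fun f => ?_⟩).symm⟩
  · apply LinearMap.restrictScalars_injective R
    exact IsLocalizedModule.ext p.primeCompl (LocalizedModule.mkLinearMap p.primeCompl D) hunit hfg
  · refine ⟨(IsLocalizedModule.lift p.primeCompl (LocalizedModule.mkLinearMap p.primeCompl D) f
      hunit).extendScalarsOfIsLocalization p.primeCompl A, ?_⟩
    exact IsLocalizedModule.lift_comp p.primeCompl (LocalizedModule.mkLinearMap p.primeCompl D) f
      hunit

end Localization

/-- Over a `d`-dimensional Cohen-Macaulay noetherian ring `R` with dualizing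
module `D`: if `J` is the minimal injective resolution of `D` and `E = E_R(R/p)`, then
`Hom_R(J, E)` is a flat resolution (over `R` and over `R_p`) of
`Hom_R(D, E) ≅ Hom_{R_p}(D_p, E_{R_p}(κ(p)))`, and `fd_R(Hom_R(D,E)) ≤ ht p`. -/
theorem statement6 (R : Type u) [CommRing R] [IsNoetherianRing R]
    (hCM : IsCohenMacaulayRing R) (d : ℕ) (hd : ringKrullDim R = ((d : ℕ∞) : WithBot ℕ∞))
    (D : Type u) [AddCommGroup D] [Module R D] (hD : IsDualizing R D)
    (p : Ideal R) (hp : p.IsPrime)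
    (J : MinimalInjRes R D)
    (E : Type u) [AddCommGroup E] [Module R E]
    [Module (Localization.AtPrime p) E] [IsScalarTower R (Localization.AtPrime p) E]
    (hE : IsInjectiveHull R (R ⧸ p) E)
    (E' : Type u) [AddCommGroup E'] [Module (Localization.AtPrime p) E']
    (hE' : IsInjectiveHull (Localization.AtPrime p)
      (IsLocalRing.ResidueField (Localization.AtPrime p)) E')
    (h : ℕ) (hh : (h : ℕ∞) = Order.height (⟨p, hp⟩ : PrimeSpectrum R)) :
    -- exactness of the augmented dual complex ⋯ → Hom(J¹,E) → Hom(J⁰,E) → Hom(D,E) → 0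
    (Function.Surjective (LinearMap.lcomp R E J.ε)) ∧
    (LinearMap.range (LinearMap.lcomp R E (J.d 0)) =
      LinearMap.ker (LinearMap.lcomp R E J.ε)) ∧
    (∀ i : ℕ, LinearMap.range (LinearMap.lcomp R E (J.d (i + 1))) =
      LinearMap.ker (LinearMap.lcomp R E (J.d i))) ∧
    -- each term is flat over R and over R_p
    (∀ i : ℕ, Module.Flat R (J.J i →ₗ[R] E)) ∧
    (∀ i : ℕ, Module.Flat (Localization.AtPrime p) (J.J i →ₗ[R] E)) ∧
    -- Hom_R(D,E) ≅ Hom_{R_p}(D_p, E_{R_p}(κ(p)))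
    Nonempty ((D →ₗ[R] E) ≃ₗ[Localization.AtPrime p]
      (LocalizedModule p.primeCompl D →ₗ[Localization.AtPrime p] E')) ∧
    -- fd_R(Hom_R(D,E)) ≤ ht p
    FlatDimLE R h (ModuleCat.of R (D →ₗ[R] E)) := by
  have hpE : ∀ s ∉ p, ∀ x : E, s • x = 0 → x = 0 := fun s hs x h0 =>
    eq_zero_of_notMem_smul_eq_zero hs h0
  have hflat : ∀ i, Module.Flat R (J.J i →ₗ[R] E) := fun i =>
    ExtTorsion.flat_hom hE.1 hpE fun a => ExtTorsion.of_injective hp.ne_top (J.inj i) _ 0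
  refine ⟨hE.1.lcomp_surjective J.ε_inj, hE.1.range_lcomp_eq_ker J.exct0,
    fun i => hE.1.range_lcomp_eq_ker (J.exct i), hflat, fun i => ?_, ?_, ?_⟩
  · exact (Module.flat_iff_of_isLocalization (Localization.AtPrime p) p.primeCompl _).2 (hflat i)
  · obtain ⟨e⟩ := nonempty_hom_linearEquiv_localizedModule_hom (p := p) D E
    obtain ⟨e'⟩ := hE.atPrime.nonempty_linearEquiv hE'
    exact ⟨e.trans (e'.congrRight)⟩
  · obtain ⟨hDf, -, -⟩ := hD.1
    obtain ⟨n, hn⟩ := hD.2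
    exact ExtTorsion.flatDimLE_hom hp.ne_top hE.1 hpE h fun a => ExtTorsion.of_injDimLE hn hh _
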